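/- Suppose each μⱼ and ν are doubling, let E ⊆ S_μ ∩ S_ν be a Borel set with H^{q,t}_{μ,ν}(E) < ∞, and let F ⊆ E be an H^{q,t}_{μ,ν}-measurable subset. Then D̄^{q,t}_{μ,ν}(x,E) = D̄^{q,t}_{μ,ν}(x,F) and D̲^{q,t}_{μ,ν}(x,E) = D̲^{q,t}_{μ,ν}(x,F) for H^{q,t}_{μ,ν}-almost every x ∈ F. -/

import Mathlib

open MeasureTheory Metric Set Filter ENNReal Topology

noncomputable section

namespace MixedMultifractal

variable {X : Type*} [MetricSpace X] [MeasurableSpace X]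

/-- `ℝ^d` as a Euclidean space. -/
abbrev Rd (d : ℕ) := EuclideanSpace ℝ (Fin d)

/-- A centered `δ`-covering of `E`: a countable family of closed balls with centers in `E`
and radii in `(0, δ)` covering `E`. -/
def IsCenteredCover (E : Set X) (δ : ℝ) (I : Set (X × ℝ)) : Prop :=
  I.Countable ∧ (∀ p ∈ I, p.1 ∈ E ∧ 0 < p.2 ∧ p.2 < δ) ∧
    E ⊆ ⋃ p ∈ I, closedBall p.1 p.2

/-- A centered `δ`-packing of `E`: a countable family of pairwise disjoint closed balls
with centers in `E` and radii in `(0, δ)`. -/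
def IsCenteredPacking (E : Set X) (δ : ℝ) (I : Set (X × ℝ)) : Prop :=
  I.Countable ∧ (∀ p ∈ I, p.1 ∈ E ∧ 0 < p.2 ∧ p.2 < δ) ∧
    I.Pairwise fun p p' => Disjoint (closedBall p.1 p.2) (closedBall p'.1 p'.2)

/-- Pre-measure `H̄_δ` associated with a gauge `g` on balls (a ball is coded by its
center-radius pair). -/
def preH (g : X × ℝ → ℝ≥0∞) (δ : ℝ) (E : Set X) : ℝ≥0∞ :=
  ⨅ (I : Set (X × ℝ)) (_ : IsCenteredCover E δ I), ∑' p : I, g (p : X × ℝ)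

/-- `H̄ = sup_{δ > 0} H̄_δ` (the limit as `δ ↓ 0`). -/
def barH (g : X × ℝ → ℝ≥0∞) (E : Set X) : ℝ≥0∞ :=
  ⨆ (δ : ℝ) (_ : 0 < δ), preH g δ E

/-- The (generalized) multifractal Hausdorff measure: `H(E) = sup_{F ⊆ E} H̄(F)`. -/
def mixedH (g : X × ℝ → ℝ≥0∞) (E : Set X) : ℝ≥0∞ :=
  ⨆ (F : Set X) (_ : F ⊆ E), barH g F

/-- Pre-measure `P̄_δ` associated with a gauge `g` on balls. -/
def preP (g : X × ℝ → ℝ≥0∞) (δ : ℝ) (E : Set X) : ℝ≥0∞ :=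
  ⨆ (I : Set (X × ℝ)) (_ : IsCenteredPacking E δ I), ∑' p : I, g (p : X × ℝ)

/-- `P̄ = inf_{δ > 0} P̄_δ` (the limit as `δ ↓ 0`). -/
def barP (g : X × ℝ → ℝ≥0∞) (E : Set X) : ℝ≥0∞ :=
  ⨅ (δ : ℝ) (_ : 0 < δ), preP g δ E

/-- The (generalized) multifractal packing measure:
`P(E) = inf { Σ P̄(Eₙ) : E ⊆ ⋃ Eₙ }`. -/
def mixedP (g : X × ℝ → ℝ≥0∞) (E : Set X) : ℝ≥0∞ :=
  ⨅ (s : ℕ → Set X) (_ : E ⊆ ⋃ n, s n), ∑' n, barP g (s n)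

/-- The mixed multifractal gauge `μ(B(x,r))^q · ν(B(x,r))^t` with
`μ(B)^q = ∏ⱼ μⱼ(B)^{qⱼ}` (here `^` is `ENNReal.rpow`, so `0 ^ s = ∞` for `s < 0` and
`0 ^ 0 = 1`). -/
def mgauge {k : ℕ} (μ : Fin k → Measure X) (q : Fin k → ℝ) (ν : Measure X) (t : ℝ) :
    X × ℝ → ℝ≥0∞ :=
  fun p => (∏ j, μ j (closedBall p.1 p.2) ^ q j) * ν (closedBall p.1 p.2) ^ t

/-- The non-mixed multifractal gauge `μ(B(x,r))^q · (2r)^s`. -/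
def sgauge {k : ℕ} (μ : Fin k → Measure X) (q : Fin k → ℝ) (s : ℝ) :
    X × ℝ → ℝ≥0∞ :=
  fun p => (∏ j, μ j (closedBall p.1 p.2) ^ q j) * ENNReal.ofReal (2 * p.2) ^ s

/-- The topological support of a measure. -/
def msupport (σ : Measure X) : Set X :=
  {x : X | ∀ r : ℝ, 0 < r → 0 < σ (closedBall x r)}

/-- `S_μ = supp μ₁ ∩ … ∩ supp μ_k`. -/
def Smu {k : ℕ} (μ : Fin k → Measure X) : Set X := ⋂ j, msupport (μ j)

/-- A measure `σ` is doubling if for some `a > 1`,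
`limsup_{r ↓ 0} sup_{x ∈ supp σ} σ(B(x,ar))/σ(B(x,r)) < ∞`. -/
def IsDoubling (σ : Measure X) : Prop :=
  ∃ a : ℝ, 1 < a ∧
    limsup (fun r : ℝ => ⨆ x ∈ msupport σ, σ (closedBall x (a * r)) / σ (closedBall x r))
      (𝓝[>] (0 : ℝ)) < ⊤

/-- `ν` is quasi-Ahlfors regular with index `α`: `limsup_{|U| → 0} ν(U)/|U|^α < ∞`,
i.e. there are `M < ∞` and `δ > 0` with `ν(U) ≤ M · |U|^α` whenever `|U| < δ`. -/
def IsQuasiAhlfors (ν : Measure X) (α : ℝ) : Prop :=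
  ∃ M : ℝ≥0∞, M ≠ ⊤ ∧ ∃ δ : ℝ, 0 < δ ∧
    ∀ U : Set X, EMetric.diam U < ENNReal.ofReal δ → ν U ≤ M * EMetric.diam U ^ α

/-- The upper `(q,t)`-density of `θ` at `x` relative to `(μ, ν)`. -/
def upperDensity {k : ℕ} (μ : Fin k → Measure X) (q : Fin k → ℝ) (ν : Measure X) (t : ℝ)
    (θ : Measure X) (x : X) : ℝ≥0∞ :=
  limsup (fun r : ℝ => θ (closedBall x r) / mgauge μ q ν t (x, r)) (𝓝[>] (0 : ℝ))

/-- The lower `(q,t)`-density of `θ` at `x` relative to `(μ, ν)`. -/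
def lowerDensity {k : ℕ} (μ : Fin k → Measure X) (q : Fin k → ℝ) (ν : Measure X) (t : ℝ)
    (θ : Measure X) (x : X) : ℝ≥0∞ :=
  liminf (fun r : ℝ => θ (closedBall x r) / mgauge μ q ν t (x, r)) (𝓝[>] (0 : ℝ))

/-- The upper density at `x` of a set function `m` evaluated on `E ∩ B(x,r)`, relative to
the mixed gauge; used for `D̄` (with `m = H^{q,t}`) and `Δ̄` (with `m = P^{q,t}`). -/
def upperSetDensity {k : ℕ} (m : Set X → ℝ≥0∞) (μ : Fin k → Measure X) (q : Fin k → ℝ)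
    (ν : Measure X) (t : ℝ) (E : Set X) (x : X) : ℝ≥0∞ :=
  limsup (fun r : ℝ => m (E ∩ closedBall x r) / mgauge μ q ν t (x, r)) (𝓝[>] (0 : ℝ))

/-- The lower density at `x` of a set function `m` evaluated on `E ∩ B(x,r)`; used for `D̲`
and `Δ̲`. -/
def lowerSetDensity {k : ℕ} (m : Set X → ℝ≥0∞) (μ : Fin k → Measure X) (q : Fin k → ℝ)
    (ν : Measure X) (t : ℝ) (E : Set X) (x : X) : ℝ≥0∞ :=
  liminf (fun r : ℝ => m (E ∩ closedBall x r) / mgauge μ q ν t (x, r)) (𝓝[>] (0 : ℝ))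

/-- The mixed multifractal Hausdorff dimension `dim^q_{μ,ν}`. -/
def mixedHDim {k : ℕ} (μ : Fin k → Measure X) (q : Fin k → ℝ) (ν : Measure X)
    (A : Set X) : ℝ :=
  sInf {s : ℝ | mixedH (mgauge μ q ν s) A = 0}

/-- The mixed multifractal packing dimension `Dim^q_{μ,ν}`. -/
def mixedPDim {k : ℕ} (μ : Fin k → Measure X) (q : Fin k → ℝ) (ν : Measure X)
    (A : Set X) : ℝ :=
  sInf {s : ℝ | mixedP (mgauge μ q ν s) A = 0}

/-- Carathéodory measurability of `F` with respect to a set function `m`. -/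
def CaratheodoryMeasurable (m : Set X → ℝ≥0∞) (F : Set X) : Prop :=
  ∀ A : Set X, m A = m (A ∩ F) + m (A \ F)

/-- `D̄^{q,t}_{μ,ν}(x, A)`: upper density of the mixed Hausdorff measure of `A` near `x`. -/
def DUpper {k : ℕ} (μ : Fin k → Measure X) (q : Fin k → ℝ) (ν : Measure X) (t : ℝ)
    (A : Set X) (x : X) : ℝ≥0∞ :=
  upperSetDensity (mixedH (mgauge μ q ν t)) μ q ν t A x

/-- `D̲^{q,t}_{μ,ν}(x, A)`: lower density of the mixed Hausdorff measure of `A` near `x`. -/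
def DLower {k : ℕ} (μ : Fin k → Measure X) (q : Fin k → ℝ) (ν : Measure X) (t : ℝ)
    (A : Set X) (x : X) : ℝ≥0∞ :=
  lowerSetDensity (mixedH (mgauge μ q ν t)) μ q ν t A x

/-- `Δ̄^{q,t}_{μ,ν}(x, A)`: upper density of the mixed packing measure of `A` near `x`. -/
def DeltaUpper {k : ℕ} (μ : Fin k → Measure X) (q : Fin k → ℝ) (ν : Measure X) (t : ℝ)
    (A : Set X) (x : X) : ℝ≥0∞ :=
  upperSetDensity (mixedP (mgauge μ q ν t)) μ q ν t A x

/-- `Δ̲^{q,t}_{μ,ν}(x, A)`: lower density of the mixed packing measure of `A` near `x`. -/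
def DeltaLower {k : ℕ} (μ : Fin k → Measure X) (q : Fin k → ℝ) (ν : Measure X) (t : ℝ)
    (A : Set X) (x : X) : ℝ≥0∞ :=
  lowerSetDensity (mixedP (mgauge μ q ν t)) μ q ν t A x

section Premeasure

variable {Y : Type*} [MetricSpace Y]

theorem preH_anti (g : Y × ℝ → ℝ≥0∞) {δ δ' : ℝ} (h : δ ≤ δ') (E : Set Y) :
    preH g δ' E ≤ preH g δ E :=
  le_iInf₂ fun I hI => iInf₂_le I
    ⟨hI.1, fun p hp => ⟨(hI.2.1 p hp).1, (hI.2.1 p hp).2.1, (hI.2.1 p hp).2.2.trans_le h⟩, hI.2.2⟩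

theorem preH_le_barH (g : Y × ℝ → ℝ≥0∞) {δ : ℝ} (hδ : 0 < δ) (E : Set Y) :
    preH g δ E ≤ barH g E :=
  le_iSup₂ (f := fun (δ : ℝ) (_ : 0 < δ) => preH g δ E) δ hδ

theorem barH_le_mixedH (g : Y × ℝ → ℝ≥0∞) {F E : Set Y} (h : F ⊆ E) :
    barH g F ≤ mixedH g E :=
  le_iSup₂ (f := fun (F : Set Y) (_ : F ⊆ E) => barH g F) F h

theorem mixedH_mono (g : Y × ℝ → ℝ≥0∞) {F E : Set Y} (h : F ⊆ E) :
    mixedH g F ≤ mixedH g E :=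
  iSup₂_le fun _ hT => barH_le_mixedH g (hT.trans h)

theorem preH_empty (g : Y × ℝ → ℝ≥0∞) (δ : ℝ) : preH g δ ∅ = 0 := by
  refine le_antisymm ((iInf₂_le ∅ ⟨countable_empty, by simp, by simp⟩).trans ?_) zero_le
  simp

theorem mixedH_empty (g : Y × ℝ → ℝ≥0∞) : mixedH g ∅ = 0 := by
  refine le_antisymm (iSup₂_le fun F hF => ?_) zero_le
  rw [subset_empty_iff.1 hF]
  exact iSup₂_le fun δ _ => (preH_empty g δ).le

theorem preH_iUnion_le (g : Y × ℝ → ℝ≥0∞) (δ : ℝ) (s : ℕ → Set Y) :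
    preH g δ (⋃ n, s n) ≤ ∑' n, preH g δ (s n) := by
  refine ENNReal.le_of_forall_pos_le_add fun ε hε hfin => ?_
  obtain ⟨ε', hε', hsum⟩ :=
    ENNReal.exists_pos_sum_of_countable (ENNReal.coe_ne_zero.2 hε.ne') ℕ
  have key : ∀ n, ∃ I, IsCenteredCover (s n) δ I ∧
      ∑' p : I, g (p : Y × ℝ) ≤ preH g δ (s n) + ε' n := by
    intro n
    have hn : preH g δ (s n) ≠ ⊤ := ENNReal.ne_top_of_tsum_ne_top hfin.ne n
    have hlt : preH g δ (s n) < preH g δ (s n) + ε' n :=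
      ENNReal.lt_add_right hn (ENNReal.coe_ne_zero.2 (hε' n).ne')
    conv_lhs at hlt => rw [preH]
    simp only [iInf_lt_iff] at hlt
    obtain ⟨I, hI, h⟩ := hlt
    exact ⟨I, hI, h.le⟩
  choose I hI hIle using key
  have hcov : IsCenteredCover (⋃ n, s n) δ (⋃ n, I n) := by
    refine ⟨countable_iUnion fun n => (hI n).1, fun p hp => ?_, fun x hx => ?_⟩
    · obtain ⟨n, hn⟩ := mem_iUnion.1 hp
      exact ⟨mem_iUnion.2 ⟨n, ((hI n).2.1 p hn).1⟩, ((hI n).2.1 p hn).2⟩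
    · obtain ⟨n, hn⟩ := mem_iUnion.1 hx
      obtain ⟨p, hp, hxp⟩ := mem_iUnion₂.1 ((hI n).2.2 hn)
      exact mem_iUnion₂.2 ⟨p, mem_iUnion.2 ⟨n, hp⟩, hxp⟩
  calc preH g δ (⋃ n, s n) ≤ ∑' p : (⋃ n, I n), g (p : Y × ℝ) := iInf₂_le _ hcov
    _ ≤ ∑' n, ∑' p : I n, g (p : Y × ℝ) := ENNReal.tsum_iUnion_le_tsum g I
    _ ≤ ∑' n, (preH g δ (s n) + ε' n) := ENNReal.tsum_le_tsum hIle
    _ = ∑' n, preH g δ (s n) + ∑' n, (ε' n : ℝ≥0∞) := ENNReal.tsum_add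
    _ ≤ ∑' n, preH g δ (s n) + ε := by gcongr

theorem mixedH_iUnion_le (g : Y × ℝ → ℝ≥0∞) (s : ℕ → Set Y) :
    mixedH g (⋃ n, s n) ≤ ∑' n, mixedH g (s n) := by
  refine iSup₂_le fun F hF => iSup₂_le fun δ hδ => ?_
  have hFs : F = ⋃ n, F ∩ s n := by rw [← inter_iUnion, inter_eq_left.2 hF]
  calc preH g δ F = preH g δ (⋃ n, F ∩ s n) := by rw [← hFs]
    _ ≤ ∑' n, preH g δ (F ∩ s n) := preH_iUnion_le g δ _
    _ ≤ ∑' n, mixedH g (s n) := ENNReal.tsum_le_tsum fun n =>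
        (preH_le_barH g hδ _).trans (barH_le_mixedH g inter_subset_right)

/-- The multifractal Hausdorff measure as an outer measure. -/
def mixedHOuter (g : Y × ℝ → ℝ≥0∞) : OuterMeasure Y where
  measureOf := mixedH g
  empty := mixedH_empty g
  mono := mixedH_mono g
  iUnion_nat s _ := mixedH_iUnion_le g s

theorem preH_add_le_of_le_dist (g : Y × ℝ → ℝ≥0∞) {δ : ℝ} {s t : Set Y}
    (h : ∀ x ∈ s, ∀ y ∈ t, δ ≤ dist x y) :
    preH g δ s + preH g δ t ≤ preH g δ (s ∪ t) := by
  refine le_iInf₂ fun I hI => ?_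
  have hs : IsCenteredCover s δ {p ∈ I | p.1 ∈ s} := by
    refine ⟨hI.1.mono (sep_subset _ _), fun p hp => ⟨hp.2, (hI.2.1 p hp.1).2⟩, fun x hx => ?_⟩
    obtain ⟨p, hp, hxp⟩ := mem_iUnion₂.1 (hI.2.2 (Or.inl hx))
    obtain ⟨hp1, -, hpδ⟩ := hI.2.1 p hp
    refine mem_iUnion₂.2 ⟨p, ⟨hp, hp1.resolve_right fun hpt => ?_⟩, hxp⟩
    linarith [h x hx p.1 hpt, mem_closedBall.1 hxp]
  have ht : IsCenteredCover t δ {p ∈ I | p.1 ∈ t} := by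
    refine ⟨hI.1.mono (sep_subset _ _), fun p hp => ⟨hp.2, (hI.2.1 p hp.1).2⟩, fun x hx => ?_⟩
    obtain ⟨p, hp, hxp⟩ := mem_iUnion₂.1 (hI.2.2 (Or.inr hx))
    obtain ⟨hp1, -, hpδ⟩ := hI.2.1 p hp
    refine mem_iUnion₂.2 ⟨p, ⟨hp, hp1.resolve_left fun hps => ?_⟩, hxp⟩
    linarith [h p.1 hps x hx, mem_closedBall'.1 hxp]
  have hdisj : Disjoint {p ∈ I | p.1 ∈ s} {p ∈ I | p.1 ∈ t} := by
    refine Set.disjoint_left.2 fun p hps hpt => ?_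
    have := h p.1 hps.2 p.1 hpt.2
    rw [dist_self] at this
    linarith [(hI.2.1 p hps.1).2.1, (hI.2.1 p hps.1).2.2]
  calc preH g δ s + preH g δ t
      ≤ ∑' p : {p ∈ I | p.1 ∈ s}, g (p : Y × ℝ) + ∑' p : {p ∈ I | p.1 ∈ t}, g (p : Y × ℝ) :=
        add_le_add (iInf₂_le _ hs) (iInf₂_le _ ht)
    _ = ∑' p : ({p ∈ I | p.1 ∈ s} ∪ {p ∈ I | p.1 ∈ t} : Set (Y × ℝ)), g (p : Y × ℝ) :=
        (ENNReal.summable.tsum_union_disjoint hdisj ENNReal.summable).symm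
    _ ≤ ∑' p : I, g (p : Y × ℝ) :=
        ENNReal.tsum_mono_subtype g (union_subset (sep_subset _ _) (sep_subset _ _))

theorem barH_add_le_of_areSeparated (g : Y × ℝ → ℝ≥0∞) {s t : Set Y}
    (h : Metric.AreSeparated s t) : barH g s + barH g t ≤ barH g (s ∪ t) := by
  obtain ⟨ρ, hρ, hst⟩ := h
  obtain ⟨ε, hε, hερ⟩ := ENNReal.lt_iff_exists_nnreal_btwn.1 (pos_iff_ne_zero.2 hρ)
  have hε0 : (0 : ℝ) < ε := by exact_mod_cast ENNReal.coe_pos.1 hε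
  have hdist : ∀ x ∈ s, ∀ y ∈ t, (ε : ℝ) ≤ dist x y := fun x hx y hy => by
    have := hερ.le.trans (hst x hx y hy)
    rw [edist_nndist, ENNReal.coe_le_coe] at this
    exact_mod_cast this
  refine ENNReal.biSup_add_biSup_le' (p := fun δ : ℝ => 0 < δ) (q := fun δ : ℝ => 0 < δ)
    ⟨1, one_pos⟩ ⟨1, one_pos⟩ fun δ₁ h₁ δ₂ h₂ => ?_
  have hδ : 0 < min (ε : ℝ) (min δ₁ δ₂) := lt_min hε0 (lt_min h₁ h₂)
  calc preH g δ₁ s + preH g δ₂ t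
      ≤ preH g (min (ε : ℝ) (min δ₁ δ₂)) s + preH g (min (ε : ℝ) (min δ₁ δ₂)) t :=
        add_le_add (preH_anti g (by simp) s) (preH_anti g (by simp) t)
    _ ≤ preH g (min (ε : ℝ) (min δ₁ δ₂)) (s ∪ t) := preH_add_le_of_le_dist g fun x hx y hy =>
        (min_le_left _ _).trans (hdist x hx y hy)
    _ ≤ barH g (s ∪ t) := preH_le_barH g hδ _

theorem mixedHOuter_isMetric (g : Y × ℝ → ℝ≥0∞) : (mixedHOuter g).IsMetric := by
  intro s t hst
  refine le_antisymm (measure_union_le s t) ?_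
  refine ENNReal.biSup_add_biSup_le' (p := fun F : Set Y => F ⊆ s) (q := fun F : Set Y => F ⊆ t)
    ⟨∅, empty_subset _⟩ ⟨∅, empty_subset _⟩ fun s' hs t' ht => ?_
  exact (barH_add_le_of_areSeparated g (hst.mono hs ht)).trans
    (barH_le_mixedH g (union_subset_union hs ht))

end Premeasure

/-- If small balls centered on `T` have `ψ`-mass at most `c` times the gauge, then the
`ψ`-mass of `T` is at most `c H̄(T)`. -/
theorem measure_le_mul_barH (g : X × ℝ → ℝ≥0∞) (ψ : Measure X) {c : ℝ≥0∞} {T : Set X}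
    (hc0 : c ≠ 0) (hc : c ≠ ⊤)
    {δ : ℝ} (hδ : 0 < δ) (hT : ∀ x ∈ T, ∀ r, 0 < r → r < δ → ψ (closedBall x r) ≤ c * g (x, r)) :
    ψ T ≤ c * barH g T := by
  refine le_trans ?_ (mul_le_mul_right (preH_le_barH g hδ T) c)
  rw [preH, ENNReal.mul_iInf_of_ne hc0 hc]
  refine le_iInf fun I => ?_
  rw [ENNReal.mul_iInf_of_ne hc0 hc]
  refine le_iInf fun hI => ?_
  calc ψ T ≤ ψ (⋃ p ∈ I, closedBall p.1 p.2) := measure_mono hI.2.2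
    _ ≤ ∑' p : I, ψ (closedBall p.1.1 p.1.2) := measure_biUnion_le ψ hI.1 _
    _ ≤ ∑' p : I, c * g p := ENNReal.tsum_le_tsum fun p =>
        hT _ (hI.2.1 p p.2).1 _ (hI.2.1 p p.2).2.1 (hI.2.1 p p.2).2.2
    _ = c * ∑' p : I, g p := ENNReal.tsum_mul_left

/-- Joint upper semicontinuity from outside of a gauge, at the balls centered on `S`: slightly
enlarging a ball and moving its center by less than the enlargement hardly increases `g`. -/
def GaugeUSCOn (g : X × ℝ → ℝ≥0∞) (S : Set X) : Prop :=
  ∀ x ∈ S, ∀ r, 0 < r → ∀ a, g (x, r) < a →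
    ∀ᶠ η in 𝓝[>] (0 : ℝ), ∀ y, dist y x ≤ η → g (y, r + η) < a

section Borel

variable [BorelSpace X]

/-- The multifractal Hausdorff measure as a Borel measure. -/
def mixedHMeasure (g : X × ℝ → ℝ≥0∞) : Measure X :=
  (mixedHOuter g).toMeasure (mixedHOuter_isMetric g).le_caratheodory

theorem mixedHMeasure_apply (g : X × ℝ → ℝ≥0∞) {s : Set X} (hs : MeasurableSet s) :
    mixedHMeasure g s = mixedH g s :=
  toMeasure_apply _ _ hs

theorem mixedH_le_mixedHMeasure (g : X × ℝ → ℝ≥0∞) (s : Set X) :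
    mixedH g s ≤ mixedHMeasure g s :=
  le_toMeasure_apply (mixedHOuter g) _ s

theorem measurableSet_frequently_lt (g : X × ℝ → ℝ≥0∞) (θ : Measure X) {c : ℝ≥0∞} (hc0 : c ≠ 0)
    (hc : c ≠ ⊤) {E : Set X} (hE : MeasurableSet E) (hg : GaugeUSCOn g E) :
    MeasurableSet {x ∈ E | ∃ᶠ r in 𝓝[>] (0 : ℝ), c * g (x, r) < θ (closedBall x r)} := by
  set W : ℕ → Set X := fun n =>
    {x | ∃ r, 0 < r ∧ r < 1 / ((n : ℝ) + 1) ∧ c * g (x, r) < θ (closedBall x r)} with hW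
  have hopen : ∀ n, E ∩ W n ⊆ interior (W n) := by
    rintro n x ⟨hx, r, hr, hrn, hlt⟩
    have hlt' : g (x, r) < θ (closedBall x r) / c :=
      (ENNReal.lt_div_iff_mul_lt (Or.inl hc0) (Or.inl hc)).2 (by rwa [mul_comm])
    obtain ⟨η, hη, hη0, hηn⟩ :=
      ((hg x hx r hr _ hlt').and (Ioo_mem_nhdsGT (sub_pos.2 hrn))).exists
    refine mem_interior_iff_mem_nhds.2 (mem_of_superset (ball_mem_nhds x hη0) fun y hy => ?_)
    have hyx : dist y x ≤ η := (mem_ball.1 hy).le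
    refine ⟨r + η, by linarith, by linarith, ?_⟩
    have h1 := hη y hyx
    rw [ENNReal.lt_div_iff_mul_lt (Or.inl hc0) (Or.inl hc), mul_comm] at h1
    exact h1.trans_le (measure_mono
      (closedBall_subset_closedBall' (by rw [dist_comm]; gcongr)))
  have heq : {x ∈ E | ∃ᶠ r in 𝓝[>] (0 : ℝ), c * g (x, r) < θ (closedBall x r)}
      = E ∩ ⋂ n, interior (W n) := by
    ext x
    constructor
    · rintro ⟨hx, hfr⟩
      refine ⟨hx, mem_iInter.2 fun n => hopen n ⟨hx, ?_⟩⟩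
      obtain ⟨r, hr, hr0, hrn⟩ :=
        (hfr.and_eventually (Ioo_mem_nhdsGT (Nat.one_div_pos_of_nat (α := ℝ) (n := n)))).exists
      exact ⟨r, hr0, hrn, hr⟩
    · rintro ⟨hx, hxW⟩
      refine ⟨hx, (nhdsGT_basis (0 : ℝ)).frequently_iff.2 fun ε hε => ?_⟩
      obtain ⟨n, hn⟩ := exists_nat_one_div_lt hε
      obtain ⟨r, hr0, hrn, hr⟩ := interior_subset (mem_iInter.1 hxW n)
      exact ⟨r, ⟨hr0, hrn.trans hn⟩, hr⟩
  rw [heq]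
  exact hE.inter (MeasurableSet.iInter fun n => isOpen_interior.measurableSet)

variable [SecondCountableTopology X] [HasBesicovitchCovering X]

/-- Vitali-type estimate: if the `ψ`-mass of arbitrarily small balls centered on `T` dominates
`c` times the gauge, then the `ψ`-mass of `T` dominates `c` times `H̄(T)`. The measure `θ`
only serves to discard a null set in the Besicovitch covering theorem. -/
theorem mul_barH_le_of_frequently (g : X × ℝ → ℝ≥0∞) (θ ψ : Measure X) [IsFiniteMeasure θ]
    [IsFiniteMeasure ψ] {c : ℝ≥0∞} {T : Set X}
    (hnull : ∀ T' ⊆ T, θ T' = 0 → mixedH g T' = 0)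
    (hT : ∀ x ∈ T, ∃ᶠ r in 𝓝[>] (0 : ℝ), c * g (x, r) ≤ ψ (closedBall x r)) :
    c * barH g T ≤ ψ T := by
  refine le_of_forall_gt fun a ha => ?_
  obtain ⟨a', ha', haa'⟩ := exists_between ha
  obtain ⟨U, hTU, hU, hUa⟩ := Set.exists_isOpen_lt_of_lt T a' ha'
  refine lt_of_le_of_lt ?_ (hUa.trans haa')
  simp only [barH, ENNReal.mul_iSup]
  refine iSup₂_le fun δ hδ => ?_
  have hf : ∀ x ∈ T, ∀ ε > 0,
      ({r | c * g (x, r) ≤ ψ (closedBall x r) ∧ closedBall x r ⊆ U} ∩ Ioo 0 ε).Nonempty := by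
    intro x hx ε hε
    obtain ⟨ρ, hρ, hρU⟩ := Metric.nhds_basis_closedBall.mem_iff.1 (hU.mem_nhds (hTU hx))
    obtain ⟨r, hr, hr'⟩ := ((hT x hx).and_eventually
      (Ioo_mem_nhdsGT (lt_min hε hρ))).exists
    exact ⟨r, ⟨hr, (closedBall_subset_closedBall (hr'.2.le.trans (min_le_right _ _))).trans hρU⟩,
      hr'.1, hr'.2.trans_le (min_le_left _ _)⟩
  obtain ⟨t, r, htc, htT, htr, hθ, hdisj⟩ :=
    Besicovitch.exists_disjoint_closedBall_covering_ae θ _ T hf (fun _ => δ) fun _ _ => hδ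
  set B := ⋃ x ∈ t, closedBall x (r x) with hB
  have hcov : IsCenteredCover (T ∩ B) δ ((fun x => (x, r x)) '' t) := by
    refine ⟨htc.image _, ?_, ?_⟩
    · rintro _ ⟨x, hx, rfl⟩
      have hrx := (htr x hx).2
      exact ⟨⟨htT hx, mem_iUnion₂.2 ⟨x, hx, mem_closedBall_self hrx.1.le⟩⟩, hrx.1, hrx.2⟩
    · rintro y ⟨-, hy⟩
      simpa only [biUnion_image] using hy
  have hsum : c * preH g δ (T ∩ B) ≤ ψ U := by
    have hinj : InjOn (fun x => (x, r x)) t := fun x _ y _ h => congrArg Prod.fst h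
    calc c * preH g δ (T ∩ B)
        ≤ c * ∑' p : (fun x => (x, r x)) '' t, g p := by gcongr; exact iInf₂_le _ hcov
      _ = ∑' x : t, c * g (x, r x) := by rw [tsum_image g hinj, ENNReal.tsum_mul_left]
      _ ≤ ∑' x : t, ψ (closedBall (x : X) (r x)) :=
          ENNReal.tsum_le_tsum fun x => (htr x x.2).1.1
      _ = ψ B := (measure_biUnion htc hdisj fun _ _ => isClosed_closedBall.measurableSet).symm
      _ ≤ ψ U := measure_mono (iUnion₂_subset fun x hx => (htr x hx).1.2)
  have hrest : preH g δ (T \ B) = 0 := le_antisymm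
    (((preH_le_barH g hδ _).trans (barH_le_mixedH g subset_rfl)).trans
      (hnull _ sdiff_subset hθ).le) zero_le
  have hsub : preH g δ T ≤ preH g δ (T ∩ B) := by
    have h := preH_iUnion_le g δ fun n : ℕ => if n = 0 then T ∩ B else if n = 1 then T \ B else ∅
    have hU : (⋃ n : ℕ, if n = 0 then T ∩ B else if n = 1 then T \ B else ∅) = T := by
      ext x
      simp only [mem_iUnion]
      constructor
      · rintro ⟨n, hn⟩
        split_ifs at hn
        exacts [hn.1, hn.1, hn.elim]
      · intro hx
        by_cases hxB : x ∈ B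
        exacts [⟨0, hx, hxB⟩, ⟨1, hx, hxB⟩]
    rw [hU] at h
    refine h.trans (le_of_eq ?_)
    refine (tsum_eq_single 0 fun n hn => ?_).trans (by simp)
    rw [if_neg hn]
    split_ifs
    exacts [hrest, preH_empty g δ]
  exact (by gcongr : c * preH g δ T ≤ c * preH g δ (T ∩ B)).trans hsum

theorem mul_mixedH_le_of_frequently (g : X × ℝ → ℝ≥0∞) (θ ψ : Measure X) [IsFiniteMeasure θ]
    [IsFiniteMeasure ψ] {c : ℝ≥0∞} {T : Set X}
    (hnull : ∀ T' ⊆ T, θ T' = 0 → mixedH g T' = 0)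
    (hT : ∀ x ∈ T, ∃ᶠ r in 𝓝[>] (0 : ℝ), c * g (x, r) ≤ ψ (closedBall x r)) :
    c * mixedH g T ≤ ψ T := by
  simp only [mixedH, ENNReal.mul_iSup]
  exact iSup₂_le fun T' hT' => (mul_barH_le_of_frequently g θ ψ
    (fun S hS => hnull S (hS.trans hT')) fun x hx => hT x (hT' hx)).trans (measure_mono hT')

/-- On subsets of a Borel set of finite measure, `H` agrees with the outer measure induced by
its restriction to the Borel sets; that is, `H` is Borel regular there. -/
theorem mixedHMeasure_restrict_apply_of_subset (g : X × ℝ → ℝ≥0∞) {E : Set X}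
    (hE : MeasurableSet E) (hfin : mixedH g E < ⊤) (hg : GaugeUSCOn g E) {S : Set X}
    (hS : S ⊆ E) : (mixedHMeasure g).restrict E S = mixedH g S := by
  set θ := (mixedHMeasure g).restrict E with hθ
  have hle : ∀ T ⊆ E, mixedH g T ≤ θ T := fun T hT => by
    rw [hθ, Measure.restrict_apply' hE, inter_eq_left.2 hT]
    exact mixedH_le_mixedHMeasure g T
  have : IsFiniteMeasure θ := ⟨by
    rwa [hθ, Measure.restrict_apply_univ, mixedHMeasure_apply g hE]⟩
  refine le_antisymm ?_ (hle S hS)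
  have hSfin : mixedH g S ≠ ⊤ := ((mixedH_mono g hS).trans_lt hfin).ne
  have key : ∀ c : ℝ≥0∞, 1 < c → c ≠ ⊤ → θ S ≤ c * mixedH g S := by
    intro c hc1 hc
    have hc0 : c ≠ 0 := (zero_lt_one.trans hc1).ne'
    set N := {x ∈ E | ∃ᶠ r in 𝓝[>] (0 : ℝ), c * g (x, r) < θ (closedBall x r)} with hN
    have hNm : MeasurableSet N := measurableSet_frequently_lt g θ hc0 hc hE hg
    have hNE : N ⊆ E := sep_subset _ _
    have hNθ : θ N = mixedH g N := by
      rw [hθ, Measure.restrict_apply hNm, inter_eq_left.2 hNE, mixedHMeasure_apply g hNm]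
    have hN0 : θ N = 0 := by
      have h := mul_mixedH_le_of_frequently g θ θ (c := c) (T := N)
        (fun T hT h0 => le_antisymm ((hle T (hT.trans hNE)).trans h0.le) zero_le)
        fun x hx => hx.2.mono fun r hr => hr.le
      rw [← hNθ] at h
      by_contra hne
      have := ENNReal.mul_lt_mul_left hne (measure_ne_top θ N) hc1
      rw [one_mul] at this
      exact (this.trans_le h).false
    set A : ℕ → Set X := fun n => {x ∈ S | ∀ r, 0 < r → r < 1 / ((n : ℝ) + 1) →
      θ (closedBall x r) ≤ c * g (x, r)} with hA
    have hmono : Monotone A := fun m n hmn x hx => ⟨hx.1, fun r hr hrn =>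
      hx.2 r hr (hrn.trans_le (Nat.one_div_le_one_div hmn))⟩
    have hsub : S ⊆ N ∪ ⋃ n, A n := by
      intro x hx
      by_cases hxN : x ∈ N
      · exact Or.inl hxN
      · have hev : ∀ᶠ r in 𝓝[>] (0 : ℝ), θ (closedBall x r) ≤ c * g (x, r) := by
          have := Filter.not_frequently.1 fun h => hxN ⟨hS hx, h⟩
          simpa only [not_lt] using this
        obtain ⟨ε, hε, hεr⟩ := (nhdsGT_basis (0 : ℝ)).eventually_iff.1 hev
        obtain ⟨n, hn⟩ := exists_nat_one_div_lt hε
        exact Or.inr (mem_iUnion.2 ⟨n, hx, fun r hr hrn => hεr ⟨hr, hrn.trans hn⟩⟩)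
    calc θ S ≤ θ N + θ (⋃ n, A n) := (measure_mono hsub).trans (measure_union_le _ _)
      _ = ⨆ n, θ (A n) := by rw [hN0, zero_add, hmono.measure_iUnion]
      _ ≤ c * mixedH g S := iSup_le fun n =>
          (measure_le_mul_barH g θ hc0 hc Nat.one_div_pos_of_nat fun x hx => hx.2).trans
            (mul_le_mul_right (barH_le_mixedH g (sep_subset _ _)) c)
  have hlim : Tendsto (fun c : ℝ≥0∞ => c * mixedH g S) (𝓝[>] 1) (𝓝 (1 * mixedH g S)) :=
    ENNReal.Tendsto.mul_const (tendsto_id.mono_left nhdsWithin_le_nhds) (Or.inr hSfin)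
  rw [one_mul] at hlim
  have : (𝓝[>] (1 : ℝ≥0∞)).NeBot := nhdsGT_neBot_of_exists_gt ⟨⊤, ENNReal.one_lt_top⟩
  exact ge_of_tendsto hlim (mem_of_superset (Ioo_mem_nhdsGT ENNReal.one_lt_top)
    fun c hc => key c hc.1 hc.2.ne)

/-- The complement `E \ F` of a measurable set `F ⊆ E` has density zero almost everywhere
on `F`. -/
theorem mixedH_frequently_le_sdiff_eq_zero (g : X × ℝ → ℝ≥0∞) {E : Set X}
    (hE : MeasurableSet E) (hfin : mixedH g E < ⊤) (hg : GaugeUSCOn g E) {F : Set X}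
    (hFE : F ⊆ E) (hF : CaratheodoryMeasurable (mixedH g) F) {c : ℝ≥0∞} (hc0 : c ≠ 0) :
    mixedH g {x ∈ F | ∃ᶠ r in 𝓝[>] (0 : ℝ),
      c * g (x, r) ≤ mixedH g ((E \ F) ∩ closedBall x r)} = 0 := by
  set θ := (mixedHMeasure g).restrict E with hθ
  have heq : ∀ S ⊆ E, θ S = mixedH g S := fun S hS =>
    mixedHMeasure_restrict_apply_of_subset g hE hfin hg hS
  have : IsFiniteMeasure θ := ⟨by
    rwa [hθ, Measure.restrict_apply_univ, mixedHMeasure_apply g hE]⟩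
  set A := E \ F with hA
  have hAE : A ⊆ E := sdiff_subset
  have hψF : θ.restrict A F = 0 := by
    have hm := measurableSet_toMeasurable θ A
    rw [← Measure.restrict_toMeasurable (measure_ne_top θ A), Measure.restrict_apply' hm]
    have h1 : θ E = θ F + θ A := by
      rw [heq E subset_rfl, heq F hFE, heq A hAE, hF E, inter_eq_right.2 hFE]
    have h2 : θ E ≤ θ A + θ (F \ toMeasurable θ A) := by
      have hsub : E ⊆ toMeasurable θ A ∪ F \ toMeasurable θ A := fun x hx => by
        by_cases hxA : x ∈ toMeasurable θ A
        · exact Or.inl hxA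
        · refine Or.inr ⟨?_, hxA⟩
          by_contra hxF
          exact hxA (subset_toMeasurable θ A ⟨hx, hxF⟩)
      refine (measure_mono hsub).trans ((measure_union_le _ _).trans ?_)
      rw [measure_toMeasurable]
    have h3 := measure_inter_add_sdiff F hm (μ := θ)
    rw [h1, ← h3, add_comm (θ A)] at h2
    have h4 := (ENNReal.add_le_add_iff_right (measure_ne_top θ A)).1 h2
    have h5 : θ (F ∩ toMeasurable θ A) + θ (F \ toMeasurable θ A)
        ≤ 0 + θ (F \ toMeasurable θ A) := by rwa [zero_add]
    exact le_antisymm ((ENNReal.add_le_add_iff_right (measure_ne_top θ _)).1 h5) zero_le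
  have h := mul_mixedH_le_of_frequently g θ (θ.restrict A) (c := c)
    (T := {x ∈ F | ∃ᶠ r in 𝓝[>] (0 : ℝ), c * g (x, r) ≤ mixedH g (A ∩ closedBall x r)})
    (fun T hT h0 => by rwa [← heq T ((hT.trans (sep_subset _ _)).trans hFE)])
    fun x hx => hx.2.mono fun r hr => by
      rwa [Measure.restrict_apply isClosed_closedBall.measurableSet, inter_comm,
        heq _ (inter_subset_left.trans hAE)]
  have h0 := le_antisymm (h.trans ((measure_mono (sep_subset _ _)).trans hψF.le)) zero_le
  exact (mul_eq_zero.1 h0).resolve_left hc0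

end Borel

theorem gaugeUSCOn_mgauge [BorelSpace X] {k : ℕ} (μ : Fin k → Measure X) (ν : Measure X)
    [∀ j, IsFiniteMeasure (μ j)] [IsFiniteMeasure ν] (q : Fin k → ℝ) (t : ℝ) :
    GaugeUSCOn (mgauge μ q ν t) (Smu μ ∩ msupport ν) := by
  intro x hx r hr
  set L : Filter (ℝ × X) := comap Prod.fst (𝓝[>] (0 : ℝ)) ⊓ 𝓟 {p | dist p.2 x ≤ p.1} with hL
  have hmeas : ∀ σ : Measure X, IsFiniteMeasure σ →
      Tendsto (fun p : ℝ × X => σ (closedBall p.2 (r + p.1))) L (𝓝 (σ (closedBall x r))) := by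
    intro σ _
    have hup : Tendsto (fun s => σ (closedBall x s)) (𝓝[>] r) (𝓝 (σ (closedBall x r))) := by
      have h := tendsto_measure_biInter_gt (μ := σ) (s := fun s => closedBall x s) (a := r)
        (fun s _ => isClosed_closedBall.nullMeasurableSet)
        (fun i j _ hij => closedBall_subset_closedBall hij)
        ⟨r + 1, by simp, measure_ne_top σ _⟩
      rwa [show (⋂ s > r, closedBall x s) = closedBall x r by
        ext y; simp only [mem_iInter, mem_closedBall]
        exact ⟨fun h => le_of_forall_gt_imp_ge_of_dense h, fun h s hs => h.trans hs.le⟩] at h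
    have hfst : Tendsto (fun p : ℝ × X => r + 2 * p.1) L (𝓝[>] r) := by
      have h1 : Tendsto (fun η : ℝ => r + 2 * η) (𝓝[>] 0) (𝓝[>] r) := by
        refine tendsto_nhdsWithin_iff.2 ⟨?_, ?_⟩
        · have : Continuous fun η : ℝ => r + 2 * η := by fun_prop
          simpa using (this.tendsto 0).mono_left nhdsWithin_le_nhds
        · filter_upwards [self_mem_nhdsWithin] with η hη
          have : (0 : ℝ) < η := hη
          simp [this]
      exact h1.comp (tendsto_comap.mono_left inf_le_left)
    have hdist : ∀ᶠ p in L, dist p.2 x ≤ p.1 := mem_inf_of_right (mem_principal_self _)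
    refine tendsto_of_tendsto_of_tendsto_of_le_of_le' tendsto_const_nhds (hup.comp hfst) ?_ ?_
    · filter_upwards [hdist] with p hp
      exact measure_mono (closedBall_subset_closedBall' (by rw [dist_comm]; gcongr))
    · filter_upwards [hdist] with p hp
      exact measure_mono (closedBall_subset_closedBall' (by linarith))
  have hpow : ∀ σ : Measure X, IsFiniteMeasure σ → x ∈ msupport σ → ∀ s : ℝ,
      σ (closedBall x r) ^ s ≠ 0 ∧ σ (closedBall x r) ^ s ≠ ⊤ := fun σ _ hxσ s =>
    ⟨(ENNReal.rpow_pos (hxσ r hr) (measure_ne_top σ _)).ne',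
      ENNReal.rpow_ne_top_of_ne_zero (hxσ r hr).ne' (measure_ne_top σ _)⟩
  have hxμ : ∀ j, x ∈ msupport (μ j) := mem_iInter.1 hx.1
  have hlim : Tendsto (fun p : ℝ × X => mgauge μ q ν t (p.2, r + p.1)) L
      (𝓝 (mgauge μ q ν t (x, r))) := by
    refine ENNReal.Tendsto.mul ?_ (Or.inr (hpow ν inferInstance hx.2 t).2)
      ((hmeas ν inferInstance).ennrpow_const t)
      (Or.inr (ENNReal.prod_ne_top fun j _ => (hpow (μ j) inferInstance (hxμ j) (q j)).2))
    exact ENNReal.tendsto_finsetProd_of_ne_top _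
      (fun j _ => (hmeas (μ j) inferInstance).ennrpow_const (q j))
      fun j _ => (hpow (μ j) inferInstance (hxμ j) (q j)).2
  intro a ha
  have h := hlim.eventually_lt_const ha
  rw [hL, eventually_inf_principal, eventually_comap] at h
  exact h.mono fun η hη y hy => hη (η, y) rfl hy

theorem limsup_add_eq_of_forall_eventually_le {ι : Type*} {l : Filter ι} [l.NeBot]
    {u v : ι → ℝ≥0∞} (hv : ∀ n : ℕ, ∀ᶠ i in l, v i ≤ ((n : ℝ≥0∞) + 1)⁻¹) :
    limsup (fun i => u i + v i) l = limsup u l := by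
  refine le_antisymm ?_ (limsup_le_limsup (Eventually.of_forall fun i => le_self_add))
  refine ENNReal.le_of_forall_pos_le_add fun ε hε _ => ?_
  obtain ⟨n, hn⟩ := ENNReal.exists_inv_nat_lt (ENNReal.coe_ne_zero.2 hε.ne')
  rw [← limsup_add_const l u _ (by isBoundedDefault) (by isBoundedDefault)]
  refine limsup_le_limsup ?_
  filter_upwards [hv n] with i hi
  gcongr
  exact hi.trans ((ENNReal.inv_le_inv.2 le_self_add).trans hn.le)

theorem liminf_add_eq_of_forall_eventually_le {ι : Type*} {l : Filter ι} [l.NeBot]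
    {u v : ι → ℝ≥0∞} (hv : ∀ n : ℕ, ∀ᶠ i in l, v i ≤ ((n : ℝ≥0∞) + 1)⁻¹) :
    liminf (fun i => u i + v i) l = liminf u l := by
  refine le_antisymm ?_ (liminf_le_liminf (Eventually.of_forall fun i => le_self_add))
  refine ENNReal.le_of_forall_pos_le_add fun ε hε _ => ?_
  obtain ⟨n, hn⟩ := ENNReal.exists_inv_nat_lt (ENNReal.coe_ne_zero.2 hε.ne')
  rw [← liminf_add_const l u _ (by isBoundedDefault) (by isBoundedDefault)]
  refine liminf_le_liminf ?_
  filter_upwards [hv n] with i hi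
  gcongr
  exact hi.trans ((ENNReal.inv_le_inv.2 le_self_add).trans hn.le)

/-- with doubling measures, `H^{q,t}_{μ,ν}(E) < ∞` and `F ⊆ E` an
`H^{q,t}_{μ,ν}`-measurable subset, the upper and lower densities relative to `E` and to
`F` coincide `H^{q,t}_{μ,ν}`-a.e. on `F`. -/
theorem density_restriction_ae
    (d k : ℕ) (hd : 1 ≤ d) (hk : 1 ≤ k)
    (μ : Fin k → Measure (Rd d)) (ν : Measure (Rd d))
    (hμ : ∀ j, IsProbabilityMeasure (μ j)) (hν : IsProbabilityMeasure ν)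
    (hμD : ∀ j, IsDoubling (μ j)) (hνD : IsDoubling ν)
    (q : Fin k → ℝ) (t : ℝ)
    (E : Set (Rd d)) (hE : MeasurableSet E) (hES : E ⊆ Smu μ ∩ msupport ν)
    (hfin : mixedH (mgauge μ q ν t) E < ⊤)
    (F : Set (Rd d)) (hFE : F ⊆ E)
    (hF : CaratheodoryMeasurable (mixedH (mgauge μ q ν t)) F) :
    mixedH (mgauge μ q ν t)
      {x ∈ F | ¬ (DUpper μ q ν t E x = DUpper μ q ν t F x ∧
                  DLower μ q ν t E x = DLower μ q ν t F x)} = 0 := by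
  set H := mixedH (mgauge μ q ν t) with hH
  set bad : ℕ → Set (Rd d) := fun n => {x ∈ F | ∃ᶠ r in 𝓝[>] (0 : ℝ),
    ((n : ℝ≥0∞) + 1)⁻¹ * mgauge μ q ν t (x, r) ≤ H ((E \ F) ∩ closedBall x r)} with hbad
  have hg : GaugeUSCOn (mgauge μ q ν t) E := fun x hx => gaugeUSCOn_mgauge μ ν q t x (hES hx)
  have hbad0 : ∀ n, mixedHOuter (mgauge μ q ν t) (bad n) = 0 := fun n =>
    mixedH_frequently_le_sdiff_eq_zero _ hE hfin hg hFE hF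
      (ENNReal.inv_ne_zero.2 (by finiteness))
  refine measure_mono_null (μ := mixedHOuter (mgauge μ q ν t)) ?_ (measure_iUnion_null hbad0)
  rintro x ⟨hxF, hx⟩
  by_contra hxbad
  refine hx ?_
  have hv : ∀ n : ℕ, ∀ᶠ r in 𝓝[>] (0 : ℝ),
      H ((E \ F) ∩ closedBall x r) / mgauge μ q ν t (x, r) ≤ ((n : ℝ≥0∞) + 1)⁻¹ := by
    intro n
    have hn := fun h => hxbad (mem_iUnion.2 ⟨n, hxF, h⟩)
    exact (Filter.not_frequently.1 hn).mono fun r hr =>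
      ENNReal.div_le_of_le_mul (not_le.1 hr).le
  have hadd : (fun r => H (E ∩ closedBall x r) / mgauge μ q ν t (x, r)) = fun r =>
      H (F ∩ closedBall x r) / mgauge μ q ν t (x, r) +
        H ((E \ F) ∩ closedBall x r) / mgauge μ q ν t (x, r) := by
    funext r
    rw [hF (E ∩ closedBall x r), ENNReal.add_div, inter_right_comm, inter_eq_right.2 hFE,
      inter_sdiff_right_comm]
  simp only [DUpper, DLower, upperSetDensity, lowerSetDensity, ← hH, hadd]
  exact ⟨limsup_add_eq_of_forall_eventually_le hv, liminf_add_eq_of_forall_eventually_le hv⟩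

end MixedMultifractal
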